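/- Let (Ω,μ) be a finite measure space, X a Banach space, and 1 ≤ p < ∞. A subset V of the Lebesgue–Bochner space L^p(μ;X) is relatively compact (in norm) if and only if V is uniformly L^p-integrable, uniformly tight, and scalarly relatively compact. -/

import Mathlib

open MeasureTheory ENNReal Filter

theorem dm_compact {X : Type*} [NormedAddCommGroup X] [NormedSpace ℝ X]
    {D : Set X} (hD : IsCompact D) {η : ℝ} (hη : 0 < η) :
    ∃ S : Finset (X →L[ℝ] ℝ), ∀ z ∈ D, ‖z‖ ≤ η + ∑ L ∈ S, ‖L z‖ := by
  obtain ⟨S, hS⟩ := hD.elim_finite_subcover (fun L : X →L[ℝ] ℝ => {z | ‖z‖ < η + ‖L z‖})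
    (fun L => isOpen_lt (by fun_prop) (by fun_prop)) (by
      intro z _
      obtain ⟨g, _, hg⟩ := exists_dual_vector'' ℝ z
      simp only [Set.mem_iUnion, Set.mem_ofPred_eq]
      refine ⟨g, ?_⟩
      rw [hg]
      simp [hη])
  refine ⟨S, fun z hz => ?_⟩
  have := hS hz
  simp only [Set.mem_iUnion, Set.mem_ofPred_eq] at this
  obtain ⟨L, hL, h⟩ := this
  have := Finset.single_le_sum (f := fun L : X →L[ℝ] ℝ => ‖L z‖) (fun i _ => norm_nonneg _) hL
  linarith

theorem dm_scalar {Ω : Type*} [MeasurableSpace Ω] {X : Type*} [NormedAddCommGroup X]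
    [NormedSpace ℝ X] {μ : Measure Ω} {p : ℝ≥0∞} (f g : Lp X p μ) (L : X →L[ℝ] ℝ) :
    eLpNorm (fun ω => ‖L (f ω - g ω)‖) p μ = edist (L.compLp f) (L.compLp g) := by
  rw [eLpNorm_norm, Lp.edist_def]
  apply eLpNorm_congr_ae
  filter_upwards [L.coeFn_compLp f, L.coeFn_compLp g] with ω h1 h2
  simp [h1, h2]

theorem dm_key {Ω : Type*} [MeasurableSpace Ω] {X : Type*} [NormedAddCommGroup X]
    [NormedSpace ℝ X] {μ : Measure Ω} {p : ℝ≥0∞} (hp : 1 ≤ p) (hp' : p ≠ ∞)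
    (f g : Lp X p μ) (S : Finset (X →L[ℝ] ℝ)) {η r : ℝ} (hη : 0 ≤ η) (hr : 0 ≤ r) (B : Set Ω)
    (hB : ∀ ω ∉ B, ‖f ω - g ω‖ ≤ η + ∑ L ∈ S, ‖L (f ω - g ω)‖) :
    edist f g ≤ ENNReal.ofReal η * μ Set.univ ^ (1 / p.toReal)
      + ∑ L ∈ S, edist (L.compLp f) (L.compLp g)
      + eLpNorm (Set.indicator {ω | r < ‖f ω‖} f) p μ
      + eLpNorm (Set.indicator {ω | r < ‖g ω‖} g) p μ
      + ENNReal.ofReal (2 * r) * μ B ^ (1 / p.toReal) := by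
  have hp0 : p ≠ 0 := (zero_lt_one.trans_le hp).ne'
  set B' := toMeasurable μ B with hB'
  have mB' : MeasurableSet B' := measurableSet_toMeasurable _ _
  have ind : ∀ f : Lp X p μ, AEStronglyMeasurable (fun ω =>
      ‖Set.indicator {ω | r < ‖f ω‖} f ω‖) μ := fun f =>
    (((Lp.stronglyMeasurable f).indicator
      (measurableSet_lt measurable_const (Lp.stronglyMeasurable f).norm.measurable)).norm).aestronglyMeasurable
  have sm : ∀ L ∈ S, AEStronglyMeasurable (fun ω => ‖L (f ω - g ω)‖) μ := fun L _ =>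
    (L.continuous.comp_stronglyMeasurable
      ((Lp.stronglyMeasurable f).sub (Lp.stronglyMeasurable g))).norm.aestronglyMeasurable
  have sms : AEStronglyMeasurable (∑ L ∈ S, fun ω => ‖L (f ω - g ω)‖) μ :=
    Finset.aestronglyMeasurable_sum _ sm
  have c1 : AEStronglyMeasurable (fun _ : Ω => η) μ := aestronglyMeasurable_const
  have c2 : AEStronglyMeasurable (B'.indicator (fun _ : Ω => 2 * r)) μ :=
    (stronglyMeasurable_const.indicator mB').aestronglyMeasurable
  rw [Lp.edist_def]
  calc eLpNorm (⇑f - ⇑g) p μ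
      ≤ eLpNorm ((fun _ : Ω => η) + (∑ L ∈ S, fun ω => ‖L (f ω - g ω)‖)
          + (fun ω => ‖Set.indicator {ω | r < ‖f ω‖} f ω‖)
          + (fun ω => ‖Set.indicator {ω | r < ‖g ω‖} g ω‖)
          + B'.indicator (fun _ : Ω => 2 * r)) p μ := by
        apply eLpNorm_mono_real
        intro ω
        simp only [Pi.sub_apply, Pi.add_apply, Finset.sum_apply]
        have s0 : 0 ≤ ∑ L ∈ S, ‖L (f ω - g ω)‖ := Finset.sum_nonneg fun _ _ => norm_nonneg _
        have i1 := norm_nonneg (Set.indicator {ω | r < ‖f ω‖} f ω)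
        have i2 := norm_nonneg (Set.indicator {ω | r < ‖g ω‖} g ω)
        by_cases h : ω ∈ B'
        · have aux : ∀ f : Lp X p μ, ‖f ω‖ ≤ ‖Set.indicator {ω | r < ‖f ω‖} f ω‖ + r := by
            intro f
            by_cases h : r < ‖f ω‖
            · rw [Set.indicator_of_mem (by exact h)]; linarith
            · rw [Set.indicator_of_notMem (by exact h)]; simp; linarith
          rw [Set.indicator_of_mem h]
          have := norm_sub_le (f ω) (g ω)
          have := aux f
          have := aux g
          linarith
        · rw [Set.indicator_of_notMem h]
          have := hB ω (fun h' => h (subset_toMeasurable μ B h'))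
          linarith
    _ ≤ eLpNorm (fun _ : Ω => η) p μ + ∑ L ∈ S, eLpNorm (fun ω => ‖L (f ω - g ω)‖) p μ
          + eLpNorm (fun ω => ‖Set.indicator {ω | r < ‖f ω‖} f ω‖) p μ
          + eLpNorm (fun ω => ‖Set.indicator {ω | r < ‖g ω‖} g ω‖) p μ
          + eLpNorm (B'.indicator (fun _ : Ω => 2 * r)) p μ := by
        refine (eLpNorm_add_le (((c1.add sms).add (ind f)).add (ind g)) c2 hp).trans ?_
        gcongr
        refine (eLpNorm_add_le ((c1.add sms).add (ind f)) (ind g) hp).trans ?_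
        gcongr
        refine (eLpNorm_add_le (c1.add sms) (ind f) hp).trans ?_
        gcongr
        refine (eLpNorm_add_le c1 sms hp).trans ?_
        gcongr
        exact eLpNorm_sum_le sm hp
    _ ≤ _ := by
        gcongr ?_ + ?_ + ?_ + ?_ + ?_
        · rw [eLpNorm_const' _ hp0 hp', Real.enorm_of_nonneg hη]
        · exact (Finset.sum_congr rfl fun L _ => dm_scalar f g L).le
        · rw [eLpNorm_norm]
        · rw [eLpNorm_norm]
        · refine (eLpNorm_indicator_const_le _ _).trans ?_
          rw [Real.enorm_of_nonneg (by linarith), hB', measure_toMeasurable]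

theorem dm_step {Ω : Type*} [MeasurableSpace Ω] {X : Type*} [NormedAddCommGroup X]
    {μ : Measure Ω} {p : ℝ≥0∞} [hp : Fact (1 ≤ p)] (hp' : p ≠ ∞)
    {V : Set (Lp X p μ)} (hV : TotallyBounded V) {η : ℝ} (hη : 0 < η) {e : ℝ≥0∞} (he : e ≠ 0) :
    ∃ F : Set X, F.Finite ∧ ∀ f ∈ V, μ {ω | f ω ∉ ⋃ y ∈ F, Metric.closedBall y η} ≤ e := by
  have hp0 : p ≠ 0 := (zero_lt_one.trans_le hp.out).ne'
  have hpr : 0 < p.toReal := ENNReal.toReal_pos hp0 hp'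
  set δ := ENNReal.ofReal η * e ^ (1 / p.toReal) with hδ
  have hη0 : ENNReal.ofReal η ≠ 0 := by simpa using hη
  have hδ0 : δ ≠ 0 := by
    refine mul_ne_zero hη0 ?_
    simp [ENNReal.rpow_eq_zero_iff, he, hpr.le]
  obtain ⟨t, ht, hVt⟩ := EMetric.totallyBounded_iff.1 hV (δ / 2) (ENNReal.half_pos hδ0)
  choose s hs hs' using fun y : Lp X p μ =>
    (Lp.memLp y).exists_simpleFunc_eLpNorm_sub_lt hp' (ENNReal.half_pos hδ0).ne'
  refine ⟨⋃ y ∈ t, Set.range (s y), ht.biUnion fun y _ => (s y).finite_range, fun f hf => ?_⟩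
  have := hVt hf
  simp only [Set.mem_iUnion] at this
  obtain ⟨y, hy, hfy⟩ := this
  have hfy' : eLpNorm (⇑f - ⇑y) p μ < δ / 2 := by
    rw [← Lp.edist_def]; exact hfy
  have hd : eLpNorm (⇑f - ⇑(s y)) p μ ≤ δ := by
    have : (⇑f - ⇑(s y)) = (⇑f - ⇑y) + (⇑y - ⇑(s y)) := by abel
    rw [this]
    refine (eLpNorm_add_le ((Lp.aestronglyMeasurable f).sub (Lp.aestronglyMeasurable y))
      ((Lp.aestronglyMeasurable y).sub (hs' y).1) hp.out).trans ?_
    rw [← ENNReal.add_halves δ]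
    exact add_le_add hfy'.le (hs y).le
  calc μ {ω | f ω ∉ ⋃ y ∈ (⋃ y ∈ t, Set.range (s y)), Metric.closedBall y η}
      ≤ μ {ω | ENNReal.ofReal η ≤ ‖(⇑f - ⇑(s y)) ω‖ₑ} := by
        apply measure_mono
        intro ω hω
        simp only [Set.mem_ofPred_eq] at hω ⊢
        by_contra hcon
        apply hω
        rw [not_le, ← ofReal_norm, ENNReal.ofReal_lt_ofReal_iff hη] at hcon
        simp only [Set.mem_iUnion]
        refine ⟨s y ω, ⟨y, hy, ω, rfl⟩, ?_⟩
        rw [Metric.mem_closedBall, dist_eq_norm]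
        exact hcon.le
    _ ≤ (ENNReal.ofReal η)⁻¹ ^ p.toReal * eLpNorm (⇑f - ⇑(s y)) p μ ^ p.toReal :=
        meas_ge_le_mul_pow_eLpNorm_enorm μ hp0 hp'
          ((Lp.aestronglyMeasurable f).sub (hs' y).1) hη0 (by simp)
    _ ≤ (ENNReal.ofReal η)⁻¹ ^ p.toReal * δ ^ p.toReal := by gcongr
    _ = e := by
        rw [← ENNReal.mul_rpow_of_nonneg _ _ hpr.le, hδ, ← mul_assoc,
          ENNReal.inv_mul_cancel hη0 (by simp), one_mul, ← ENNReal.rpow_mul,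
          one_div_mul_cancel hpr.ne', ENNReal.rpow_one]

theorem dm_tight {Ω : Type*} [MeasurableSpace Ω] {X : Type*} [NormedAddCommGroup X]
    [CompleteSpace X]
    {μ : Measure Ω} {p : ℝ≥0∞} [hp : Fact (1 ≤ p)] (hp' : p ≠ ∞)
    {V : Set (Lp X p μ)} (hV : TotallyBounded V) {e : ℝ≥0∞} (he : e ≠ 0) :
    ∃ K : Set X, IsCompact K ∧ ∀ f ∈ V, μ {ω | f ω ∉ K} ≤ e := by
  obtain ⟨e', he', hsum⟩ := ENNReal.exists_pos_sum_of_countable' he ℕ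
  choose F hF hFV using fun n : ℕ =>
    dm_step hp' hV (η := 1 / ((n : ℝ) + 1)) Nat.one_div_pos_of_nat (he' n).ne'
  refine ⟨⋂ n : ℕ, ⋃ y ∈ F n, Metric.closedBall y (1 / ((n : ℝ) + 1)), ?_, fun f hf => ?_⟩
  · apply TotallyBounded.isCompact_of_isClosed
    · rw [Metric.totallyBounded_iff]
      intro ε hε
      obtain ⟨n, hn⟩ := exists_nat_one_div_lt hε
      refine ⟨F n, hF n, (Set.iInter_subset _ n).trans ?_⟩
      exact Set.iUnion₂_mono fun y _ => Metric.closedBall_subset_ball hn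
    · exact isClosed_iInter fun n => (hF n).isClosed_biUnion fun _ _ => Metric.isClosed_closedBall
  · have : {ω | f ω ∉ ⋂ n : ℕ, ⋃ y ∈ F n, Metric.closedBall y (1 / ((n : ℝ) + 1))}
        = ⋃ n : ℕ, {ω | f ω ∉ ⋃ y ∈ F n, Metric.closedBall y (1 / ((n : ℝ) + 1))} := by
      ext ω
      simp only [Set.mem_ofPred_eq, Set.mem_iInter, not_forall, Set.mem_iUnion (s := fun n : ℕ =>
        {ω | f ω ∉ ⋃ y ∈ F n, Metric.closedBall y (1 / ((n : ℝ) + 1))})]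
    rw [this]
    exact (measure_iUnion_le _).trans ((ENNReal.tsum_le_tsum fun n => hFV n f hf).trans hsum.le)

theorem dm_ui {Ω : Type*} [MeasurableSpace Ω] {X : Type*} [NormedAddCommGroup X]
    {μ : Measure Ω} {p : ℝ≥0∞} [hp : Fact (1 ≤ p)]
    {V : Set (Lp X p μ)} (hV : TotallyBounded V) :
    Tendsto (fun r : ℝ =>
          ⨆ f ∈ V, eLpNorm (Set.indicator {ω | r < ‖(f : Ω → X) ω‖} (f : Ω → X)) p μ)
        atTop (nhds 0) := by
  rw [ENNReal.tendsto_nhds_zero]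
  intro e he
  obtain ⟨a, ha0, hae⟩ : ∃ a : ℝ, 0 < a ∧ 3 * ENNReal.ofReal a ≤ e := by
    obtain ⟨c, hc0, hc⟩ := ENNReal.lt_iff_exists_nnreal_btwn.1 he
    refine ⟨c / 3, by have : 0 < c := by exact_mod_cast hc0
                      positivity, ?_⟩
    have : (3 : ℝ≥0∞) = ENNReal.ofReal 3 := by simp
    rw [this, ← ENNReal.ofReal_mul (by norm_num), mul_div_cancel₀ _ (by norm_num)]
    simpa using hc.le
  obtain ⟨t, ht, hVt⟩ := EMetric.totallyBounded_iff.1 hV (ENNReal.ofReal a) (by simpa using ha0)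
  choose M hM using fun y : Lp X p μ =>
    (Lp.memLp y).eLpNorm_indicator_norm_ge_le (Lp.stronglyMeasurable y) ha0
  obtain ⟨R, hR⟩ := (ht.image M).bddAbove
  filter_upwards [eventually_ge_atTop (2 * R)] with r hr
  refine iSup₂_le fun f hf => ?_
  have := hVt hf
  simp only [Set.mem_iUnion] at this
  obtain ⟨y, hy, hfy⟩ := this
  have hfy' : eLpNorm (⇑f - ⇑y) p μ < ENNReal.ofReal a := by
    rw [← Lp.edist_def]; exact hfy
  have hMR : M y ≤ R := hR ⟨y, hy, rfl⟩
  have m1 : AEStronglyMeasurable (fun ω => ‖f ω - y ω‖) μ :=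
    ((Lp.aestronglyMeasurable f).sub (Lp.aestronglyMeasurable y)).norm
  have m2 : AEStronglyMeasurable (fun ω => ‖Set.indicator {x | M y ≤ ↑‖y x‖₊} y ω‖) μ :=
    ((Lp.stronglyMeasurable y).indicator (measurableSet_le measurable_const
      (Lp.stronglyMeasurable y).norm.measurable)).norm.aestronglyMeasurable
  calc eLpNorm (Set.indicator {ω | r < ‖f ω‖} f) p μ
      ≤ eLpNorm ((fun ω => ‖f ω - y ω‖) + (fun ω => ‖f ω - y ω‖)
          + fun ω => ‖Set.indicator {x | M y ≤ ↑‖y x‖₊} y ω‖) p μ := by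
        apply eLpNorm_mono_real
        intro ω
        simp only [Pi.add_apply]
        have h1 := norm_nonneg (f ω - y ω)
        have h2 := norm_nonneg (Set.indicator {x | M y ≤ ↑‖y x‖₊} y ω)
        by_cases h : r < ‖f ω‖
        · rw [Set.indicator_of_mem (by exact h)]
          have h3 : ‖f ω‖ ≤ ‖f ω - y ω‖ + ‖y ω‖ := by
            simpa using norm_add_le (f ω - y ω) (y ω)
          by_cases h' : M y ≤ ‖y ω‖
          · rw [Set.indicator_of_mem (by exact h')]; linarith
          · linarith
        · rw [Set.indicator_of_notMem (by exact h)]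
          simp only [norm_zero]; linarith
    _ ≤ eLpNorm (⇑f - ⇑y) p μ + eLpNorm (⇑f - ⇑y) p μ
          + eLpNorm (Set.indicator {x | M y ≤ ↑‖y x‖₊} y) p μ := by
        refine (eLpNorm_add_le (m1.add m1) m2 hp.out).trans ?_
        rw [eLpNorm_norm]
        gcongr
        refine (eLpNorm_add_le m1 m1 hp.out).trans ?_
        rw [eLpNorm_norm (fun ω => f ω - y ω)]
        exact le_rfl
    _ ≤ ENNReal.ofReal a + ENNReal.ofReal a + ENNReal.ofReal a := by
        gcongr
        exact hM y
    _ = 3 * ENNReal.ofReal a := by ring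
    _ ≤ e := hae

theorem dm_ultra {A B : Type*} [PseudoMetricSpace B] (T : A → B) {V : Set A}
    (tb : TotallyBounded (T '' V)) (U : Ultrafilter A) (hVU : V ∈ U) {b : ℝ} (hb : 0 < b) :
    ∃ t ∈ U, ∀ f ∈ t, ∀ g ∈ t, dist (T f) (T g) < b := by
  have hc := totallyBounded_iff_ultrafilter.1 tb (U.map T)
    (le_principal_iff.2 (Filter.image_mem_map hVU))
  obtain ⟨t, ht, h⟩ := (Metric.cauchy_iff.1 hc).2 b hb
  exact ⟨T ⁻¹' t, ht, fun f hf g hg => h _ hf _ hg⟩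

theorem dm_rev {Ω : Type*} [MeasurableSpace Ω] {X : Type*} [NormedAddCommGroup X]
    [NormedSpace ℝ X]
    (μ : Measure Ω) [IsFiniteMeasure μ] (p : ℝ≥0∞) [hp : Fact (1 ≤ p)] (hp' : p ≠ ∞)
    (V : Set (Lp X p μ))
    (h1 : Tendsto (fun r : ℝ =>
          ⨆ f ∈ V, eLpNorm (Set.indicator {ω | r < ‖(f : Ω → X) ω‖} (f : Ω → X)) p μ)
        atTop (nhds 0))
    (h2 : ∀ ε : ℝ, 0 < ε → ∃ K : Set X, IsCompact K ∧
          ∀ f ∈ V, μ {ω | (f : Ω → X) ω ∉ K} ≤ ENNReal.ofReal ε)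
    (h3 : ∀ L : X →L[ℝ] ℝ, IsCompact (closure ((fun f => L.compLp f) '' V))) :
    TotallyBounded V := by
  have hp0 : p ≠ 0 := (zero_lt_one.trans_le hp.out).ne'
  have hpr : 0 < p.toReal := ENNReal.toReal_pos hp0 hp'
  rw [totallyBounded_iff_ultrafilter]
  intro U hU
  have hVU : V ∈ U := by simpa using hU
  rw [Metric.cauchy_iff]
  refine ⟨U.neBot, fun ε hε => ?_⟩
  set a : ℝ := ε / 6 with ha
  have ha0 : 0 < a := by positivity
  obtain ⟨r, hr, hr1⟩ := ((ENNReal.tendsto_nhds_zero.1 h1 (ENNReal.ofReal a)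
    (by simpa using ha0)).and (eventually_ge_atTop 1)).exists
  have htail : ∀ f ∈ V, eLpNorm (Set.indicator {ω | r < ‖f ω‖} f) p μ ≤ ENNReal.ofReal a :=
    fun f hf => (le_iSup₂ (f := fun (f : Lp X p μ) (_ : f ∈ V) =>
      eLpNorm (Set.indicator {ω | r < ‖f ω‖} f) p μ) f hf).trans hr
  set d : ℝ := (a / (2 * r)) ^ p.toReal / 2 with hd
  have hd0 : 0 < d := by positivity
  obtain ⟨K, hK, hKV⟩ := h2 d hd0
  set m : ℝ≥0∞ := μ Set.univ ^ (1 / p.toReal) with hm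
  have hmt : m ≠ ∞ := ENNReal.rpow_ne_top_of_nonneg (by positivity) (measure_ne_top _ _)
  set η : ℝ := a / (m.toReal + 1) with hηd
  have hη0 : 0 < η := by positivity
  obtain ⟨S, hS⟩ := dm_compact ((hK.prod hK).image continuous_sub) hη0
  have hL : ∀ L ∈ S, ∃ t ∈ U, ∀ f ∈ t, ∀ g ∈ t,
      edist (L.compLp f) (L.compLp g) ≤ ENNReal.ofReal (a / (S.card + 1)) := by
    intro L _
    have tb : TotallyBounded ((fun f : Lp X p μ => L.compLp f) '' V) :=
      totallyBounded_closure.1 (h3 L).totallyBounded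
    obtain ⟨t, ht, h⟩ := dm_ultra (fun f : Lp X p μ => L.compLp f) tb U hVU
      (b := a / (S.card + 1)) (by positivity)
    refine ⟨t, ht, fun f hf g hg => ?_⟩
    rw [edist_dist]
    exact ENNReal.ofReal_le_ofReal (h _ hf _ hg).le
  choose! t ht htd using hL
  refine ⟨V ∩ ⋂ L ∈ S, t L, Filter.inter_mem hVU ((Filter.biInter_finset_mem S).2 ht), ?_⟩
  rintro f ⟨hfV, hft⟩ g ⟨hgV, hgt⟩
  simp only [Set.mem_iInter] at hft hgt
  have key := dm_key hp.out hp' f g S hη0.le (r := r) (by linarith)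
    ({ω | f ω ∉ K} ∪ {ω | g ω ∉ K}) (by
      intro ω hω
      simp only [Set.mem_union, Set.mem_ofPred_eq, not_or, not_not] at hω
      exact hS _ ⟨(f ω, g ω), ⟨hω.1, hω.2⟩, rfl⟩)
  have b1 : ENNReal.ofReal η * m ≤ ENNReal.ofReal a := by
    rw [← ENNReal.ofReal_toReal hmt, ← ENNReal.ofReal_mul hη0.le]
    apply ENNReal.ofReal_le_ofReal
    have : 0 ≤ m.toReal := ENNReal.toReal_nonneg
    rw [hηd, div_mul_eq_mul_div, div_le_iff₀ (by positivity)]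
    nlinarith
  have b2 : ∑ L ∈ S, edist (L.compLp f) (L.compLp g) ≤ ENNReal.ofReal a := by
    refine (Finset.sum_le_sum fun L hL => htd L hL f (hft L hL) g (hgt L hL)).trans ?_
    rw [Finset.sum_const, nsmul_eq_mul, ← ENNReal.ofReal_natCast,
      ← ENNReal.ofReal_mul (by positivity)]
    apply ENNReal.ofReal_le_ofReal
    rw [← mul_div_assoc, div_le_iff₀ (by positivity)]
    nlinarith
  have b3 : ENNReal.ofReal (2 * r) * μ ({ω | f ω ∉ K} ∪ {ω | g ω ∉ K}) ^ (1 / p.toReal)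
      ≤ ENNReal.ofReal a := by
    have : μ ({ω | f ω ∉ K} ∪ {ω | g ω ∉ K}) ≤ ENNReal.ofReal ((a / (2 * r)) ^ p.toReal) := by
      refine (measure_union_le _ _).trans ((add_le_add (hKV f hfV) (hKV g hgV)).trans ?_)
      rw [← ENNReal.ofReal_add hd0.le hd0.le, hd, add_halves]
    calc _ ≤ ENNReal.ofReal (2 * r) *
          ENNReal.ofReal ((a / (2 * r)) ^ p.toReal) ^ (1 / p.toReal) := by gcongr
      _ = ENNReal.ofReal a := by
        rw [ENNReal.ofReal_rpow_of_nonneg (by positivity) (by positivity), ← Real.rpow_mul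
          (by positivity), mul_one_div_cancel hpr.ne', Real.rpow_one,
          ← ENNReal.ofReal_mul (by positivity), mul_div_cancel₀ _ (by positivity)]
  have fin : edist f g ≤ ENNReal.ofReal (5 * a) := by
    refine key.trans ((add_le_add (add_le_add (add_le_add (add_le_add b1 b2) (htail f hfV))
      (htail g hgV)) b3).trans ?_)
    rw [ENNReal.ofReal_mul (by norm_num)]
    apply le_of_eq
    have : ENNReal.ofReal 5 = 5 := by simp
    rw [this]; ring
  rw [edist_dist, ENNReal.ofReal_le_ofReal_iff (by positivity)] at fin
  linarith

/-- **Diaz–Mayoral theorem.** A subset `V` of the Lebesgue–Bochner space `L^p(μ;X)`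
(`(Ω,μ)` a finite measure space, `X` a Banach space, `1 ≤ p < ∞`) is relatively norm
compact if and only if it is uniformly `L^p`-integrable, uniformly tight, and scalarly
relatively compact. -/
theorem diaz_mayoral
    {Ω : Type*} [MeasurableSpace Ω] {X : Type*} [NormedAddCommGroup X]
    [NormedSpace ℝ X] [CompleteSpace X]
    (μ : Measure Ω) [IsFiniteMeasure μ] (p : ℝ≥0∞) [hp : Fact (1 ≤ p)] (hp' : p ≠ ∞)
    (V : Set (Lp X p μ)) :
    IsCompact (closure V) ↔
      (Tendsto (fun r : ℝ =>
          ⨆ f ∈ V, eLpNorm (Set.indicator {ω | r < ‖(f : Ω → X) ω‖} (f : Ω → X)) p μ)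
        atTop (nhds 0)) ∧
      (∀ ε : ℝ, 0 < ε → ∃ K : Set X, IsCompact K ∧
          ∀ f ∈ V, μ {ω | (f : Ω → X) ω ∉ K} ≤ ENNReal.ofReal ε) ∧
      (∀ L : X →L[ℝ] ℝ, IsCompact (closure ((fun f => L.compLp f) '' V))) := by
  constructor
  · intro h
    have tb : TotallyBounded V := totallyBounded_closure.1 h.totallyBounded
    refine ⟨dm_ui tb, fun ε hε => dm_tight hp' tb (by simpa using hε), fun L => ?_⟩
    have hc : Continuous (fun f : Lp X p μ => L.compLp f) := (L.compLpL p μ).continuous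
    have h' := h.image hc
    exact h'.of_isClosed_subset isClosed_closure
      (closure_minimal (Set.image_mono subset_closure) h'.isClosed)
  · rintro ⟨h1, h2, h3⟩
    exact (dm_rev μ p hp' V h1 h2 h3).closure.isCompact_of_isClosed isClosed_closure
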